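/- arXiv:2506.21084 — 2 statements merged into one kernel-verified Lean document; each statement's English description precedes it below -/
import Mathlib

section
/- The neighborhood N = {(0,1), (1,0), (1,1), (1,−1), (−1,−1)} (neighborhood 199 in the 8-bit numbering of subsets of the Moore neighborhood) admits a timed crossover gate of size 12 × 12 and delay 17. -/
/-! Sandpile models on ℤ² and timed crossover gates. -/

abbrev Cell : Type := ℤ × ℤ
abbrev Config : Type := Cell → ℕ

namespace Sandpile

/-- The threshold of a sandpile model is the cardinality of its neighborhood. -/
def θ (𝒩 : Finset Cell) : ℕ := 𝒩.card

/-- The parallel sandpile dynamics: each cell reaching the threshold topples,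
sending one grain to each of its out-neighbors. -/
def F (𝒩 : Finset Cell) (c : Config) : Config := fun p =>
  c p - θ 𝒩 * (if θ 𝒩 ≤ c p then 1 else 0)
    + ∑ p' ∈ 𝒩, (if θ 𝒩 ≤ c (p - p') then 1 else 0)

/-- The configuration with a single grain at cell `p`. -/
def one (p : Cell) : Config := fun q => if q = p then 1 else 0

/-- A configuration is stable when every cell is below the threshold. -/
def Stable (𝒩 : Finset Cell) (c : Config) : Prop := ∀ p, c p < θ 𝒩

/-- The rectangle {0,…,M−1} × {0,…,N'−1}. -/
def Rect (M N' : ℕ) : Set Cell :=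
  {p | 0 ≤ p.1 ∧ p.1 < (M : ℤ) ∧ 0 ≤ p.2 ∧ p.2 < (N' : ℤ)}

/-- The four corners of the rectangle. -/
def Corners (M N' : ℕ) : Set Cell :=
  {(0, 0), ((M : ℤ) - 1, 0), (0, (N' : ℤ) - 1), ((M : ℤ) - 1, (N' : ℤ) - 1)}

/-- The four sides of the rectangle. -/
def side (M N' : ℕ) (i : Fin 4) : Set Cell :=
  if i = 0 then {p | p.1 = 0 ∧ 0 ≤ p.2 ∧ p.2 < (N' : ℤ)}
  else if i = 1 then {p | p.2 = 0 ∧ 0 ≤ p.1 ∧ p.1 < (M : ℤ)}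
  else if i = 2 then {p | p.1 = (M : ℤ) - 1 ∧ 0 ≤ p.2 ∧ p.2 < (N' : ℤ)}
  else {p | p.2 = (N' : ℤ) - 1 ∧ 0 ≤ p.1 ∧ p.1 < (M : ℤ)}

/-- A timed crossover gate of size M × N' and delay T for the sandpile model 𝒩:
a stable configuration `g` supported on the rectangle, together with four
non-corner cells `n`, `e`, `s`, `w` on four pairwise different sides, `n, s`
(resp. `w, e`) on opposite sides, such that adding a grain at `n` (resp. `w`)
makes `s` (resp. `e`) reach the threshold at time exactly `T`, while no cell
on the two other sides reaches the threshold at any time `t ≤ T`. -/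
def IsTimedCrossoverGate (𝒩 : Finset Cell) (M N' T : ℕ)
    (g : Config) (n e s w : Cell) : Prop :=
  Stable 𝒩 g ∧
  (∀ p, p ∉ Rect M N' → g p = 0) ∧
  n ∈ Rect M N' ∧ e ∈ Rect M N' ∧ s ∈ Rect M N' ∧ w ∈ Rect M N' ∧
  n ∉ Corners M N' ∧ e ∉ Corners M N' ∧ s ∉ Corners M N' ∧ w ∉ Corners M N' ∧
  ∃ iN iE iS iW : Fin 4,
    n ∈ side M N' iN ∧ e ∈ side M N' iE ∧ s ∈ side M N' iS ∧ w ∈ side M N' iW ∧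
    ((iN : ℤ) - (iS : ℤ)).natAbs = 2 ∧
    ((iW : ℤ) - (iE : ℤ)).natAbs = 2 ∧
    ({iN, iE, iS, iW} : Finset (Fin 4)) = Finset.univ ∧
    θ 𝒩 ≤ (F 𝒩)^[T] (g + one n) s ∧
    (∀ p ∈ side M N' iW ∪ side M N' iE, ∀ t ≤ T, (F 𝒩)^[t] (g + one n) p < θ 𝒩) ∧
    θ 𝒩 ≤ (F 𝒩)^[T] (g + one w) e ∧
    (∀ p ∈ side M N' iN ∪ side M N' iS, ∀ t ≤ T, (F 𝒩)^[t] (g + one w) p < θ 𝒩)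

/-- The function on cells listed column by column in `rows` on the 12 × 12 square,
and equal to `d` outside of it. -/
def tabulate (rows : List (List ℕ)) (d : ℕ) (p : Cell) : ℕ :=
  if 0 ≤ p.1 ∧ p.1 < 12 ∧ 0 ≤ p.2 ∧ p.2 < 12 then
    (rows.getD p.1.toNat []).getD p.2.toNat d
  else d

/-- If the cells at or above the threshold after each cell `p` has toppled once at time `τ p`
are predicted correctly by `τ` up to time `T`, then `τ` describes the actual dynamics. -/
theorem theta_le_iterate_F_iff (𝒩 : Finset Cell) (c : Config) (τ : Cell → ℕ) (T : ℕ)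
    (h : ∀ t ≤ T, ∀ p, (θ 𝒩 + θ 𝒩 * (if τ p < t then 1 else 0) ≤
      c p + ∑ q ∈ 𝒩, (if τ (p - q) < t then 1 else 0)) ↔ τ p = t)
    {t : ℕ} (ht : t ≤ T) (p : Cell) : θ 𝒩 ≤ (F 𝒩)^[t] c p ↔ τ p = t := by
  have key : ∀ t ≤ T, ∀ p, (F 𝒩)^[t] c p + θ 𝒩 * (if τ p < t then 1 else 0) =
      c p + ∑ q ∈ 𝒩, (if τ (p - q) < t then 1 else 0) := by
    intro t
    induction t with
    | zero => simp
    | succ t ih =>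
      intro ht p
      have ih := ih (by omega)
      have fires : ∀ p, θ 𝒩 ≤ (F 𝒩)^[t] c p ↔ τ p = t := fun p => by
        rw [← h t (by omega) p, ← ih p]; omega
      have split : ∀ p, (if τ p < t + 1 then 1 else 0) =
          (if τ p < t then 1 else 0) + (if τ p = t then 1 else 0) := fun p => by
        split_ifs <;> omega
      have hle := fires p
      have ihp := ih p
      rw [Function.iterate_succ_apply', F]
      simp only [fires, split, Finset.sum_add_distrib, mul_add]
      by_cases hp : τ p = t
      · have := hle.2 hp
        simp only [hp, lt_irrefl, if_true, if_false] at ihp ⊢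
        omega
      · simp only [hp, if_false]
        omega
  rw [← h t ht p, ← key t ht p]
  omega

/-- Neighborhood 199. -/
abbrev nbhd199 : Finset Cell := {(0,1),(1,0),(1,1),(1,-1),(-1,-1)}

theorem theta_nbhd199 : θ nbhd199 = 5 := by decide

theorem sum_nbhd199 (f : Cell → ℕ) :
    ∑ q ∈ nbhd199, f q = f (0,1) + f (1,0) + f (1,1) + f (1,-1) + f (-1,-1) := by
  simp [nbhd199, add_assoc]

/-- For neighborhood 199, predictions of toppling times need only be checked in the square that
contains all grains. -/
theorem theta_le_iterate_F_nbhd199_iff (c : Config) (rows : List (List ℕ)) (T : ℕ)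
    (hc : ∀ p, p ∉ Rect 12 12 → c p = 0)
    (h : ∀ x : ℕ, x < 12 → ∀ y : ℕ, y < 12 → ∀ t < T + 1,
      let p : Cell := ((x : ℤ), (y : ℤ))
      let τ := tabulate rows (T + 1)
      let topples := fun q : Cell => if τ q < t then 1 else 0
      (5 + 5 * topples p ≤ c p + (topples (p - (0,1)) + topples (p - (1,0)) +
        topples (p - (1,1)) + topples (p - (1,-1)) + topples (p - (-1,-1)))) ↔ τ p = t)
    {t : ℕ} (ht : t ≤ T) (p : Cell) :
    θ nbhd199 ≤ (F nbhd199)^[t] c p ↔ tabulate rows (T + 1) p = t := by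
  refine theta_le_iterate_F_iff _ _ _ T (fun t ht p => ?_) ht p
  rw [theta_nbhd199, sum_nbhd199]
  by_cases hp : p ∈ Rect 12 12
  · obtain ⟨x, y⟩ := p
    obtain ⟨hx, hx', hy, hy'⟩ := hp
    lift x to ℕ using hx
    lift y to ℕ using hy
    exact h x (by simpa using hx') y (by simpa using hy') t (by omega)
  · have outside : ∀ q, q ∉ Rect 12 12 → tabulate rows (T + 1) q = T + 1 :=
      fun q hq => if_neg hq
    have neighbor : p - (0,1) ∉ Rect 12 12 ∨ p - (1,0) ∉ Rect 12 12 := by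
      simp only [Rect, Set.mem_ofPred_eq, Prod.fst_sub, Prod.snd_sub] at hp ⊢
      push_cast at hp ⊢
      omega
    have bound : ∀ q, (if tabulate rows (T + 1) q < t then 1 else 0) ≤ 1 := fun q => by
      split_ifs <;> omega
    have vanish : ∀ q, q ∉ Rect 12 12 → (if tabulate rows (T + 1) q < t then 1 else 0) = 0 :=
      fun q hq => if_neg (by rw [outside q hq]; omega)
    have b1 := bound (p - (0,1))
    have b2 := bound (p - (1,0))
    have b3 := bound (p - (1,1))
    have b4 := bound (p - (1,-1))
    have b5 := bound (p - (-1,-1))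
    rw [hc p hp, outside p hp]
    refine iff_of_false ?_ (by omega)
    rcases neighbor with hq | hq
    · have := vanish _ hq
      omega
    · have := vanish _ hq
      omega

/-- The crossover gate, columns from west to east, each listed from south to north. -/
def gate : Config := tabulate
  [[3, 3, 3, 3, 3, 4, 4, 4, 4, 4, 4, 3],
   [4, 3, 4, 4, 3, 4, 0, 2, 3, 0, 2, 2],
   [1, 4, 3, 2, 4, 2, 4, 4, 0, 3, 2, 2],
   [4, 3, 2, 4, 0, 0, 2, 4, 0, 4, 2, 4],
   [2, 3, 3, 0, 4, 2, 4, 2, 4, 2, 3, 4],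
   [2, 4, 0, 4, 4, 0, 1, 4, 2, 4, 3, 4],
   [2, 4, 4, 1, 4, 0, 4, 4, 0, 2, 4, 3],
   [2, 4, 0, 1, 1, 3, 2, 0, 2, 0, 4, 2],
   [2, 4, 3, 4, 3, 1, 4, 2, 3, 3, 4, 2],
   [2, 3, 0, 1, 1, 2, 4, 4, 3, 4, 1, 3],
   [3, 4, 1, 4, 4, 1, 2, 1, 4, 3, 0, 4],
   [3, 3, 1, 1, 1, 3, 3, 2, 1, 2, 2, 2]] 0

/-- Toppling times when a grain enters from the west; 18 means not before time 18. -/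
def timesWest : List (List ℕ) :=
  [[18, 18, 18, 18, 18, 18, 0, 1, 2, 3, 4, 18],
   [18, 18, 18, 3, 18, 1, 18, 3, 3, 18, 18, 18],
   [18, 18, 4, 18, 2, 18, 2, 3, 18, 18, 18, 18],
   [18, 7, 18, 3, 18, 18, 18, 3, 18, 18, 18, 18],
   [18, 18, 6, 18, 4, 18, 4, 18, 4, 18, 18, 18],
   [18, 7, 18, 5, 5, 18, 18, 5, 18, 5, 18, 18],
   [18, 8, 6, 18, 6, 18, 6, 6, 18, 18, 6, 18],
   [18, 7, 18, 18, 18, 7, 8, 18, 18, 18, 7, 18],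
   [18, 8, 9, 10, 11, 12, 8, 13, 14, 15, 8, 18],
   [18, 10, 17, 15, 16, 13, 9, 9, 12, 9, 18, 18],
   [18, 11, 18, 16, 14, 17, 14, 15, 10, 11, 18, 18],
   [18, 18, 18, 18, 18, 15, 16, 16, 17, 18, 18, 18]]

/-- Toppling times when a grain enters from the north; 18 means not before time 18. -/
def timesNorth : List (List ℕ) :=
  [[18, 18, 18, 18, 18, 18, 18, 18, 18, 18, 18, 18],
   [13, 14, 11, 8, 9, 6, 18, 18, 18, 18, 18, 18],
   [18, 12, 9, 10, 7, 8, 5, 6, 18, 18, 18, 18],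
   [13, 12, 13, 8, 18, 18, 7, 4, 18, 18, 18, 18],
   [14, 14, 11, 18, 9, 18, 5, 6, 3, 18, 18, 18],
   [15, 12, 18, 10, 10, 18, 18, 4, 5, 2, 3, 0],
   [16, 13, 11, 18, 9, 18, 5, 5, 18, 4, 1, 2],
   [17, 12, 18, 18, 18, 8, 9, 18, 9, 18, 2, 3],
   [18, 13, 14, 15, 16, 17, 7, 10, 10, 8, 3, 4],
   [18, 15, 18, 18, 18, 18, 8, 6, 7, 4, 7, 5],
   [18, 16, 18, 18, 18, 18, 18, 18, 5, 6, 18, 6],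
   [18, 18, 18, 18, 18, 18, 18, 18, 18, 18, 18, 18]]

theorem gate_eq_zero (p : Cell) (hp : p ∉ Rect 12 12) : gate p = 0 := if_neg hp

theorem gate_stable : Stable nbhd199 gate := by
  intro p
  rw [theta_nbhd199]
  by_cases hp : p ∈ Rect 12 12
  · obtain ⟨x, y⟩ := p
    obtain ⟨hx, hx', hy, hy'⟩ := hp
    lift x to ℕ using hx
    lift y to ℕ using hy
    have : ∀ x : ℕ, x < 12 → ∀ y : ℕ, y < 12 → gate ((x : ℤ), (y : ℤ)) < 5 := by decide +kernel
    exact this x (by simpa using hx') y (by simpa using hy')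
  · rw [gate_eq_zero p hp]; omega

theorem gate_add_one_eq_zero {m : Cell} (hm : m ∈ Rect 12 12) (p : Cell) (hp : p ∉ Rect 12 12) :
    (gate + one m) p = 0 := by
  have hpm : p ≠ m := fun h => hp (h ▸ hm)
  simp [gate_eq_zero p hp, one, hpm]

theorem theta_le_west_iff {t : ℕ} (ht : t ≤ 17) (p : Cell) :
    θ nbhd199 ≤ (F nbhd199)^[t] (gate + one (0,6)) p ↔ tabulate timesWest 18 p = t :=
  theta_le_iterate_F_nbhd199_iff _ timesWest 17
    (gate_add_one_eq_zero (by norm_num [Rect])) (by decide +kernel) ht p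

theorem theta_le_north_iff {t : ℕ} (ht : t ≤ 17) (p : Cell) :
    θ nbhd199 ≤ (F nbhd199)^[t] (gate + one (5,11)) p ↔ tabulate timesNorth 18 p = t :=
  theta_le_iterate_F_nbhd199_iff _ timesNorth 17
    (gate_add_one_eq_zero (by norm_num [Rect])) (by decide +kernel) ht p

theorem timesWest_horizontal_sides (p : Cell) (hp : p ∈ side 12 12 3 ∪ side 12 12 1) :
    tabulate timesWest 18 p = 18 := by
  have : ∀ x : ℕ, x < 12 → tabulate timesWest 18 ((x : ℤ), 0) = 18 ∧
      tabulate timesWest 18 ((x : ℤ), 11) = 18 := by decide +kernel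
  obtain ⟨x, y⟩ := p
  rcases hp with ⟨hy, hx, hx'⟩ | ⟨hy, hx, hx'⟩ <;>
    (lift x to ℕ using hx; obtain rfl := hy)
  · exact (this x (by simpa using hx')).2
  · exact (this x (by simpa using hx')).1

theorem timesNorth_vertical_sides (p : Cell) (hp : p ∈ side 12 12 0 ∪ side 12 12 2) :
    tabulate timesNorth 18 p = 18 := by
  have : ∀ y : ℕ, y < 12 → tabulate timesNorth 18 (0, (y : ℤ)) = 18 ∧
      tabulate timesNorth 18 (11, (y : ℤ)) = 18 := by decide +kernel
  obtain ⟨x, y⟩ := p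
  rcases hp with ⟨hx, hy, hy'⟩ | ⟨hx, hy, hy'⟩ <;>
    (lift y to ℕ using hy; obtain rfl := hx)
  · exact (this y (by simpa using hy')).1
  · exact (this y (by simpa using hy')).2

theorem nbhd199_timed_crossover :
    ∃ g n e s w, IsTimedCrossoverGate
      ({(0,1),(1,0),(1,1),(1,-1),(-1,-1)} : Finset Cell) 12 12 17 g n e s w := by
  refine ⟨gate, (5,11), (11,8), (7,0), (0,6), gate_stable, gate_eq_zero, ?_, ?_, ?_, ?_, ?_, ?_,
    ?_, ?_, 3, 2, 1, 0, ?_, ?_, ?_, ?_, by decide, by decide, by decide,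
    (theta_le_north_iff le_rfl _).2 (by decide +kernel), fun p hp t ht => ?_,
    (theta_le_west_iff le_rfl _).2 (by decide +kernel), fun p hp t ht => ?_⟩
  case refine_13 =>
    rw [← not_le, theta_le_north_iff ht p, timesNorth_vertical_sides p hp]
    omega
  case refine_14 =>
    rw [← not_le, theta_le_west_iff ht p, timesWest_horizontal_sides p hp]
    omega
  all_goals simp [Rect, Corners, side, Fin.ext_iff]

end Sandpile
end

section
/- Each of the four neighborhoods N₆₇ = {(1,0), (1,−1), (−1,−1)}, N₈₃ = {(1,0), (−1,0), (1,−1), (−1,−1)}, N₈₇ = {(1,0), (−1,0), (1,1), (1,−1), (−1,−1)} and N₉₅ = {(1,0), (−1,0), (−1,1), (1,1), (1,−1), (−1,−1)} (neighborhoods 67, 83, 87 and 95 in the 8-bit numbering of subsets of the Moore neighborhood) admits a timed crossover gate, i.e. for each of them there exist a size M × N' and a delay T ∈ ℕ⁺ for which a timed crossover gate exists. -/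
namespace Sandpile

/-- Grains collected by `p` before time `t`, if every cell `q` topples exactly once, at time `τ q`,
and the grains lost by toppling are not discounted. -/
def load (𝒩 : Finset Cell) (c : Config) (τ : Cell → ℕ) (t : ℕ) (p : Cell) : ℕ :=
  c p + ∑ q ∈ 𝒩, (if τ (p - q) < t then 1 else 0)

/-- At time `t`, the toppling schedule `τ` agrees with the threshold rule at `p`. -/
def Consistent (𝒩 : Finset Cell) (c : Config) (τ : Cell → ℕ) (t : ℕ) (p : Cell) : Prop :=
  (τ p ≤ t ↔ θ 𝒩 ≤ load 𝒩 c τ t p) ∧ (τ p < t → load 𝒩 c τ t p < 2 * θ 𝒩)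

instance (𝒩 : Finset Cell) (c : Config) (τ : Cell → ℕ) (t : ℕ) (p : Cell) :
    Decidable (Consistent 𝒩 c τ t p) := by
  unfold Consistent; infer_instance

theorem iterate_F_eq {𝒩 : Finset Cell} {c : Config} {τ : Cell → ℕ} {T : ℕ}
    (h : ∀ t ≤ T, ∀ p, Consistent 𝒩 c τ t p) (t : ℕ) (ht : t ≤ T) (p : Cell) :
    (F 𝒩)^[t] c p = load 𝒩 c τ t p - θ 𝒩 * (if τ p < t then 1 else 0) := by
  induction t generalizing p with
  | zero => simp [load]
  | succ t ih =>
    have topple : ∀ q, θ 𝒩 ≤ (F 𝒩)^[t] c q ↔ τ q = t := by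
      intro q
      rw [ih (by omega) q]
      obtain ⟨h1, h2⟩ := h t (by omega) q
      by_cases hq : τ q < t
      · have := h2 hq
        simp only [hq, if_true]
        omega
      · simp only [hq, if_false]
        omega
    rw [Function.iterate_succ_apply', F]
    simp only [topple]
    rw [ih (by omega) p]
    obtain ⟨h1, h2⟩ := h t (by omega) p
    have hload : load 𝒩 c τ (t + 1) p
        = load 𝒩 c τ t p + ∑ q ∈ 𝒩, (if τ (p - q) = t then 1 else 0) := by
      simp only [load, add_assoc, ← Finset.sum_add_distrib]
      congr 1
      refine Finset.sum_congr rfl fun q _ => ?_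
      split_ifs <;> omega
    rw [hload]
    rcases lt_trichotomy (τ p) t with hp | hp | hp
    · have a : τ p ≠ t := by omega
      have b : τ p < t + 1 := by omega
      simp only [hp, a, b, if_true, if_false]
      omega
    · have a : ¬ τ p < t := by omega
      simp only [hp, if_true, lt_irrefl, if_false]
      simp only [hp, le_refl, true_iff] at h1
      simp
      omega
    · have a : ¬ τ p < t := by omega
      have b : ¬ τ p < t + 1 := by omega
      have d : τ p ≠ t := by omega
      simp [a, b, d]

theorem threshold_le_iterate_F_iff {𝒩 : Finset Cell} {c : Config} {τ : Cell → ℕ} {T : ℕ}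
    (h : ∀ t ≤ T, ∀ p, Consistent 𝒩 c τ t p) (t : ℕ) (ht : t ≤ T) (p : Cell) :
    θ 𝒩 ≤ (F 𝒩)^[t] c p ↔ τ p = t := by
  rw [iterate_F_eq h t ht p]
  obtain ⟨h1, h2⟩ := h t ht p
  by_cases hp : τ p < t
  · have := h2 hp
    simp only [hp, if_true]
    omega
  · simp only [hp, if_false]
    omega

/-- The function on cells given by a table of rows, from bottom to top, on the `M × N'` rectangle,
with constant value `d` outside. -/
def ofTable (M N' : ℕ) (L : List (List ℕ)) (d : ℕ) (p : Cell) : ℕ :=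
  if 0 ≤ p.1 ∧ p.1 < (M : ℤ) ∧ 0 ≤ p.2 ∧ p.2 < (N' : ℤ) then
    (L.getD p.2.toNat []).getD p.1.toNat d
  else d

theorem ofTable_of_notMem {M N' : ℕ} {p : Cell} (hp : p ∉ Rect M N') (L : List (List ℕ)) (d : ℕ) :
    ofTable M N' L d p = d :=
  if_neg hp

theorem consistent_of_window {𝒩 : Finset Cell} {M N' T : ℕ} {G A : List (List ℕ)} {a : Cell}
    (hθ : 0 < θ 𝒩) (h𝒩 : ∀ q ∈ 𝒩, |q.1| ≤ 1 ∧ |q.2| ≤ 1) (ha : a ∈ Rect M N')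
    (h : ∀ t < T + 1, ∀ i < M + 2, ∀ j < N' + 2,
      Consistent 𝒩 (ofTable M N' G 0 + one a) (ofTable M N' A (T + 1)) t
        ((i : ℤ) - 1, (j : ℤ) - 1)) :
    ∀ t ≤ T, ∀ p, Consistent 𝒩 (ofTable M N' G 0 + one a) (ofTable M N' A (T + 1)) t p := by
  rintro t ht ⟨x, y⟩
  by_cases hw : -1 ≤ x ∧ x ≤ M ∧ -1 ≤ y ∧ y ≤ N'
  · have := h t (by omega) (x + 1).toNat (by omega) (y + 1).toNat (by omega)
    rwa [Int.toNat_of_nonneg (by omega), Int.toNat_of_nonneg (by omega), add_sub_cancel_right,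
      add_sub_cancel_right] at this
  have hp : ((x, y) : Cell) ∉ Rect M N' := by
    simp only [Rect, Set.mem_ofPred_eq]; omega
  have hτ := ofTable_of_notMem hp A (T + 1)
  have hload : load 𝒩 (ofTable M N' G 0 + one a) (ofTable M N' A (T + 1)) t (x, y) = 0 := by
    have hne : ((x, y) : Cell) ≠ a := fun e => hp (e ▸ ha)
    have hsum : ∀ q ∈ 𝒩,
        (if ofTable M N' A (T + 1) ((x, y) - q) < t then 1 else 0) = 0 := by
      intro q hq
      obtain ⟨h1, h2⟩ := h𝒩 q hq
      rw [abs_le] at h1 h2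
      have : ((x, y) : Cell) - q ∉ Rect M N' := by
        simp only [Rect, Set.mem_ofPred_eq, Prod.fst_sub, Prod.snd_sub]; omega
      rw [ofTable_of_notMem this, if_neg (by omega)]
    rw [load, Finset.sum_eq_zero hsum, Pi.add_apply, ofTable_of_notMem hp, one, if_neg hne, Nat.add_zero]
  rw [Consistent, hload, hτ]
  omega

theorem isTimedCrossoverGate_of_tables {𝒩 : Finset Cell} {M N' T xn xs yw ye : ℕ}
    (G A B : List (List ℕ)) (hθ : 0 < θ 𝒩) (h𝒩 : ∀ q ∈ 𝒩, |q.1| ≤ 1 ∧ |q.2| ≤ 1)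
    (hx : 0 < xn ∧ xn + 1 < M ∧ 0 < xs ∧ xs + 1 < M)
    (hy : 0 < yw ∧ yw + 1 < N' ∧ 0 < ye ∧ ye + 1 < N')
    (hG : ∀ i < M, ∀ j < N', ofTable M N' G 0 ((i : ℤ), (j : ℤ)) < θ 𝒩)
    (hA : ∀ t < T + 1, ∀ i < M + 2, ∀ j < N' + 2,
      Consistent 𝒩 (ofTable M N' G 0 + one ((xn : ℤ), (N' : ℤ) - 1)) (ofTable M N' A (T + 1)) t
        ((i : ℤ) - 1, (j : ℤ) - 1))
    (hB : ∀ t < T + 1, ∀ i < M + 2, ∀ j < N' + 2,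
      Consistent 𝒩 (ofTable M N' G 0 + one (0, (yw : ℤ))) (ofTable M N' B (T + 1)) t
        ((i : ℤ) - 1, (j : ℤ) - 1))
    (hs : ofTable M N' A (T + 1) ((xs : ℤ), 0) = T)
    (he : ofTable M N' B (T + 1) ((M : ℤ) - 1, (ye : ℤ)) = T)
    (hAside : ∀ j < N', T < ofTable M N' A (T + 1) (0, (j : ℤ)) ∧
      T < ofTable M N' A (T + 1) ((M : ℤ) - 1, (j : ℤ)))
    (hBside : ∀ i < M, T < ofTable M N' B (T + 1) ((i : ℤ), 0) ∧
      T < ofTable M N' B (T + 1) ((i : ℤ), (N' : ℤ) - 1)) :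
    IsTimedCrossoverGate 𝒩 M N' T (ofTable M N' G 0)
      ((xn : ℤ), (N' : ℤ) - 1) ((M : ℤ) - 1, (ye : ℤ)) ((xs : ℤ), 0) (0, (yw : ℤ)) := by
  have hn : (((xn : ℤ), (N' : ℤ) - 1) : Cell) ∈ Rect M N' := by
    simp only [Rect, Set.mem_ofPred_eq]; omega
  have hw : ((0, (yw : ℤ)) : Cell) ∈ Rect M N' := by
    simp only [Rect, Set.mem_ofPred_eq]; omega
  have firesA := threshold_le_iterate_F_iff (consistent_of_window hθ h𝒩 hn hA)
  have firesB := threshold_le_iterate_F_iff (consistent_of_window hθ h𝒩 hw hB)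
  refine ⟨?_, fun p hp => ofTable_of_notMem hp G 0, hn, ?_, ?_, hw, ?_, ?_, ?_, ?_,
    3, 2, 1, 0, ?_, ?_, ?_, ?_, by decide, by decide, by decide,
    (firesA T le_rfl _).2 hs, ?_, (firesB T le_rfl _).2 he, ?_⟩
  · rintro ⟨x, y⟩
    by_cases hp : ((x, y) : Cell) ∈ Rect M N'
    · obtain ⟨h1, h2, h3, h4⟩ := hp
      simp only at h1 h2 h3 h4
      have := hG x.toNat (by omega) y.toNat (by omega)
      rwa [Int.toNat_of_nonneg h1, Int.toNat_of_nonneg h3] at this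
    · rw [ofTable_of_notMem hp]
      exact hθ
  · simp only [Rect, Set.mem_ofPred_eq]; omega
  · simp only [Rect, Set.mem_ofPred_eq]; omega
  · simp only [Corners, Set.mem_insert_iff, Set.mem_singleton_iff, Prod.mk.injEq]; omega
  · simp only [Corners, Set.mem_insert_iff, Set.mem_singleton_iff, Prod.mk.injEq]; omega
  · simp only [Corners, Set.mem_insert_iff, Set.mem_singleton_iff, Prod.mk.injEq]; omega
  · simp only [Corners, Set.mem_insert_iff, Set.mem_singleton_iff, Prod.mk.injEq]; omega
  · simp [side]; omega
  · simp [side]; omega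
  · simp [side]; omega
  · simp [side]; omega
  · rintro ⟨x, y⟩ hp t ht
    rw [← not_le, firesA t ht]
    have hp' : (x = 0 ∨ x = (M : ℤ) - 1) ∧ 0 ≤ y ∧ y < N' := by
      simp [side] at hp; omega
    obtain ⟨hx', hy0, hy1⟩ := hp'
    lift y to ℕ using hy0
    have := hAside y (by omega)
    rcases hx' with rfl | rfl <;> omega
  · rintro ⟨x, y⟩ hp t ht
    rw [← not_le, firesB t ht]
    have hp' : (y = 0 ∨ y = (N' : ℤ) - 1) ∧ 0 ≤ x ∧ x < M := by
      simp [side] at hp; omega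
    obtain ⟨hy', hx0, hx1⟩ := hp'
    lift x to ℕ using hx0
    have := hBside x (by omega)
    rcases hy' with rfl | rfl <;> omega

theorem nbhds_67_83_87_95_timed_crossover :
    (∃ M N' T : ℕ, 0 < M ∧ 0 < N' ∧ 0 < T ∧
      ∃ g n e s w, IsTimedCrossoverGate
        ({(1,0),(1,-1),(-1,-1)} : Finset Cell) M N' T g n e s w) ∧
    (∃ M N' T : ℕ, 0 < M ∧ 0 < N' ∧ 0 < T ∧
      ∃ g n e s w, IsTimedCrossoverGate
        ({(1,0),(-1,0),(1,-1),(-1,-1)} : Finset Cell) M N' T g n e s w) ∧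
    (∃ M N' T : ℕ, 0 < M ∧ 0 < N' ∧ 0 < T ∧
      ∃ g n e s w, IsTimedCrossoverGate
        ({(1,0),(-1,0),(1,1),(1,-1),(-1,-1)} : Finset Cell) M N' T g n e s w) ∧
    (∃ M N' T : ℕ, 0 < M ∧ 0 < N' ∧ 0 < T ∧
      ∃ g n e s w, IsTimedCrossoverGate
        ({(1,0),(-1,0),(-1,1),(1,1),(1,-1),(-1,-1)} : Finset Cell) M N' T g n e s w) := by
  refine ⟨?_, ?_, ?_, ?_⟩
  · exact ⟨5, 5, 4, by decide, by decide, by decide, _, _, _, _, _,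
      isTimedCrossoverGate_of_tables (M := 5) (N' := 5) (T := 4)
        (xn := 3) (xs := 1) (yw := 3) (ye := 1)
        [[1, 2, 0, 1, 1],
          [1, 2, 1, 2, 1],
          [1, 2, 2, 2, 1],
          [2, 2, 2, 1, 0],
          [2, 2, 2, 2, 1]]
        [[5, 4, 5, 5, 5],
          [5, 4, 3, 4, 5],
          [5, 2, 3, 2, 5],
          [5, 5, 1, 5, 5],
          [5, 5, 5, 0, 5]]
        [[5, 5, 5, 5, 5],
          [5, 3, 4, 3, 4],
          [5, 1, 2, 3, 5],
          [0, 1, 2, 5, 5],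
          [5, 5, 5, 5, 5]]
        (by decide +kernel) (by decide +kernel) (by decide +kernel) (by decide +kernel)
        (by decide +kernel) (by decide +kernel) (by decide +kernel) (by decide +kernel)
        (by decide +kernel) (by decide +kernel) (by decide +kernel)⟩
  · exact ⟨5, 5, 4, by decide, by decide, by decide, _, _, _, _, _,
      isTimedCrossoverGate_of_tables (M := 5) (N' := 5) (T := 4)
        (xn := 3) (xs := 1) (yw := 3) (ye := 1)
        [[2, 3, 2, 2, 2],
          [2, 2, 2, 3, 2],
          [1, 3, 3, 3, 1],
          [3, 1, 3, 3, 1],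
          [3, 2, 3, 3, 2]]
        [[5, 4, 5, 5, 5],
          [5, 4, 3, 4, 5],
          [5, 2, 3, 2, 5],
          [5, 5, 1, 2, 5],
          [5, 5, 1, 0, 5]]
        [[5, 5, 5, 5, 5],
          [5, 5, 4, 3, 4],
          [5, 1, 2, 3, 5],
          [0, 5, 5, 5, 5],
          [5, 5, 5, 5, 5]]
        (by decide +kernel) (by decide +kernel) (by decide +kernel) (by decide +kernel)
        (by decide +kernel) (by decide +kernel) (by decide +kernel) (by decide +kernel)
        (by decide +kernel) (by decide +kernel) (by decide +kernel)⟩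
  · exact ⟨6, 5, 5, by decide, by decide, by decide, _, _, _, _, _,
      isTimedCrossoverGate_of_tables (M := 6) (N' := 5) (T := 5)
        (xn := 1) (xs := 2) (yw := 2) (ye := 3)
        [[3, 3, 3, 3, 3, 3],
          [2, 4, 3, 3, 3, 2],
          [4, 3, 4, 4, 4, 3],
          [3, 3, 2, 4, 3, 3],
          [3, 4, 4, 3, 2, 3]]
        [[6, 6, 5, 6, 6, 6],
          [6, 4, 5, 4, 5, 6],
          [6, 6, 3, 4, 3, 6],
          [6, 6, 6, 2, 5, 6],
          [6, 0, 1, 6, 6, 6]]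
        [[6, 6, 6, 6, 6, 6],
          [6, 1, 4, 5, 6, 6],
          [0, 3, 2, 3, 4, 5],
          [6, 6, 6, 3, 4, 5],
          [6, 6, 6, 6, 6, 6]]
        (by decide +kernel) (by decide +kernel) (by decide +kernel) (by decide +kernel)
        (by decide +kernel) (by decide +kernel) (by decide +kernel) (by decide +kernel)
        (by decide +kernel) (by decide +kernel) (by decide +kernel)⟩
  · exact ⟨7, 5, 6, by decide, by decide, by decide, _, _, _, _, _,
      isTimedCrossoverGate_of_tables (M := 7) (N' := 5) (T := 6)
        (xn := 5) (xs := 5) (yw := 3) (ye := 1)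
        [[4, 4, 4, 4, 3, 5, 3],
          [4, 3, 3, 4, 4, 5, 4],
          [4, 5, 5, 5, 5, 5, 3],
          [5, 2, 3, 3, 4, 4, 2],
          [4, 3, 5, 5, 5, 5, 3]]
        [[7, 7, 7, 7, 7, 6, 7],
          [7, 7, 7, 6, 5, 6, 7],
          [7, 6, 5, 4, 5, 4, 7],
          [7, 7, 5, 4, 3, 4, 7],
          [7, 7, 3, 2, 1, 0, 7]]
        [[7, 7, 7, 7, 7, 7, 7],
          [7, 7, 6, 5, 6, 5, 6],
          [7, 1, 2, 3, 4, 5, 7],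
          [0, 7, 7, 7, 6, 7, 7],
          [7, 7, 7, 7, 7, 7, 7]]
        (by decide +kernel) (by decide +kernel) (by decide +kernel) (by decide +kernel)
        (by decide +kernel) (by decide +kernel) (by decide +kernel) (by decide +kernel)
        (by decide +kernel) (by decide +kernel) (by decide +kernel)⟩

end Sandpile
end
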